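/- For every k ≥ 2, if a topological space X is k-irresolvable, then X has a non-empty open subspace that is hereditarily k-irresolvable, namely the complement of the closure of the union of all k-resolvable subspaces. -/

import Mathlib

/-- `Y` (as a subspace of `X`) is `k`-resolvable. -/
def KResolvableOn {X : Type*} [TopologicalSpace X] (Y : Set X) (k : ℕ) : Prop :=
  ∃ f : Fin k → Set X, (∀ i, f i ⊆ Y) ∧ (∀ i, (f i).Nonempty) ∧
    (Pairwise fun i j => Disjoint (f i) (f j)) ∧ (⋃ i, f i) = Y ∧ ∀ i, Y ⊆ closure (f i)

theorem kres_of_dense {X : Type*} [TopologicalSpace X] [Nonempty X] {k : ℕ} (hk : 2 ≤ k)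
    (hd : closure (⋃₀ {Y : Set X | KResolvableOn Y k}) = Set.univ) :
    KResolvableOn (Set.univ : Set X) k := by
  obtain ⟨f, ⟨hfd, hfc⟩, hmax⟩ := zorn_le₀
    {f : Fin k → Set X | (∀ i j, i ≠ j → Disjoint (f i) (f j)) ∧ ∀ i j, f i ⊆ closure (f j)}
    (by
      intro c hc hch
      refine ⟨fun i => ⋃ f ∈ c, f i, ⟨?_, ?_⟩, ?_⟩
      · intro i j hij
        rw [Set.disjoint_left]
        intro x hx hx'
        simp only [Set.mem_iUnion] at hx hx'
        obtain ⟨f, hf, hxf⟩ := hx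
        obtain ⟨g, hg, hxg⟩ := hx'
        rcases hch.total hf hg with h | h
        · exact Set.disjoint_left.1 ((hc hg).1 i j hij) (h i hxf) hxg
        · exact Set.disjoint_left.1 ((hc hf).1 i j hij) hxf (h j hxg)
      · intro i j x hx
        simp only [Set.mem_iUnion] at hx
        obtain ⟨f, hf, hxf⟩ := hx
        refine closure_mono ?_ ((hc hf).2 i j hxf)
        intro y hy
        simp only [Set.mem_iUnion]
        exact ⟨f, hf, hy⟩
      · intro f hf i y hy
        simp only [Set.mem_iUnion]
        exact ⟨f, hf, hy⟩)
  have hY : closure (⋃ i, f i) = Set.univ := by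
    by_contra hne
    obtain ⟨x, hx⟩ := (Set.ne_univ_iff_exists_notMem _).1 hne
    set U := (closure (⋃ i, f i))ᶜ with hU
    have hUo : IsOpen U := isClosed_closure.isOpen_compl
    have hfU : ∀ i y, y ∈ f i → y ∉ U := fun i y hy hyU =>
      hyU (subset_closure (Set.mem_iUnion.2 ⟨i, hy⟩))
    have hx2 : x ∈ closure (⋃₀ {Y : Set X | KResolvableOn Y k}) := by rw [hd]; trivial
    obtain ⟨z, hzU, Z, ⟨g, _, _, hgd, hgu, hgc⟩, hzZ⟩ := mem_closure_iff.1 hx2 U hUo hx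
    have hzg := hzZ
    rw [← hgu] at hzg
    obtain ⟨i, hzi⟩ := Set.mem_iUnion.1 hzg
    have hle := hmax (y := fun i => f i ∪ (g i ∩ U)) ⟨?_, ?_⟩ (fun i => Set.subset_union_left)
    · exact hfU i z (hle i (Or.inr ⟨hzi, hzU⟩)) hzU
    · intro a b hab
      rw [Set.disjoint_left]
      rintro y (hy | hy) (hy' | hy')
      · exact Set.disjoint_left.1 (hfd a b hab) hy hy'
      · exact hfU _ _ hy hy'.2
      · exact hfU _ _ hy' hy.2
      · exact Set.disjoint_left.1 (hgd hab) hy.1 hy'.1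
    · rintro a b y (hy | hy)
      · exact closure_mono Set.subset_union_left (hfc a b hy)
      · have hyZ : y ∈ Z := hgu ▸ Set.mem_iUnion.2 ⟨a, hy.1⟩
        refine closure_mono Set.subset_union_right ?_
        rw [Set.inter_comm]
        exact hUo.inter_closure ⟨hy.2, hgc b hyZ⟩
  have hdense : ∀ i, closure (f i) = Set.univ := by
    intro i
    rw [Set.eq_univ_iff_forall]
    intro x
    have : closure (⋃ i, f i) ⊆ closure (f i) :=
      closure_minimal (Set.iUnion_subset fun j => hfc j i) isClosed_closure
    exact this (hY ▸ Set.mem_univ x)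
  let i0 : Fin k := ⟨0, by omega⟩
  have hsub : ∀ i, f i ⊆ f i ∪ {x | i = i0 ∧ ∀ j, x ∉ f j} := fun i => Set.subset_union_left
  refine ⟨fun i => f i ∪ {x | i = i0 ∧ ∀ j, x ∉ f j}, fun i => Set.subset_univ _, ?_, ?_, ?_, ?_⟩
  · intro i
    refine Set.Nonempty.mono (hsub i) ?_
    rw [← closure_nonempty_iff, hdense i]
    exact Set.univ_nonempty
  · intro a b hab
    rw [Set.disjoint_left]
    rintro y (hy | hy) (hy' | hy')
    · exact Set.disjoint_left.1 (hfd a b hab) hy hy'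
    · exact hy'.2 _ hy
    · exact hy.2 _ hy'
    · exact hab (hy.1.trans hy'.1.symm)
  · rw [Set.eq_univ_iff_forall]
    intro x
    by_cases h : ∃ j, x ∈ f j
    · obtain ⟨j, hj⟩ := h
      exact Set.mem_iUnion.2 ⟨j, Or.inl hj⟩
    · exact Set.mem_iUnion.2 ⟨i0, Or.inr ⟨rfl, fun j hj => h ⟨j, hj⟩⟩⟩
  · intro i
    rw [← hdense i]
    exact closure_mono (hsub i)

/-- Every `k`-irresolvable space (`k ≥ 2`) has a non-empty open hereditarily `k`-irresolvable
subspace, namely the complement of the closure of the union of all `k`-resolvable subspaces. -/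
theorem kIrresolvable_has_open_hereditarily_kIrresolvable {X : Type*} [TopologicalSpace X]
    [Nonempty X] {k : ℕ} (hk : 2 ≤ k)
    (hirr : ¬ KResolvableOn (Set.univ : Set X) k) :
    IsOpen (closure (⋃₀ {Y : Set X | KResolvableOn Y k}))ᶜ ∧
      (closure (⋃₀ {Y : Set X | KResolvableOn Y k}))ᶜ.Nonempty ∧
      ∀ Z : Set X, Z ⊆ (closure (⋃₀ {Y : Set X | KResolvableOn Y k}))ᶜ → Z.Nonempty →
        ¬ KResolvableOn Z k := by
  refine ⟨isClosed_closure.isOpen_compl, ?_, ?_⟩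
  · rw [Set.nonempty_compl]
    exact fun h => hirr (kres_of_dense hk h)
  · rintro Z hZ ⟨z, hz⟩ hres
    exact hZ hz (subset_closure ⟨Z, hres, hz⟩)
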